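/- Let λ > 0 and x ∈ (0,1). For t ≥ 0 define r(t) := 4·e^{−λt} / (2·(1+x)·√((1+x)² − 4·e^{−λt}·x) + 2·(1+x)² − 4·e^{−λt}·x), where √ is the real square root (the argument is positive since (1+x)² − 4x = (1−x)² > 0). Then r(0) = 1 and lim_{t→0⁺} (log r(t))/t = −λ·(1+x)/(1−x). -/

import Mathlib

open Set Filter

/-- Sharpness of the lower bound for elliptic semigroups: for the explicit elliptic
semigroup with Koenigs function `4z/(1−z)²` and spectral value `λ > 0`, the quantity
`r(t) = |φ_t(−x)/(−x)|` satisfies `r(0) = 1` and `(log r(t))/t → −λ(1+x)/(1−x)`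
as `t → 0⁺`. -/
theorem elliptic_lower_bound_sharpness
    (lam x : ℝ) (hlam : 0 < lam) (hx : x ∈ Set.Ioo (0 : ℝ) 1)
    (r : ℝ → ℝ)
    (hr : ∀ t : ℝ, r t = 4 * Real.exp (-lam * t) /
      (2 * (1 + x) * Real.sqrt ((1 + x) ^ 2 - 4 * Real.exp (-lam * t) * x) +
        2 * (1 + x) ^ 2 - 4 * Real.exp (-lam * t) * x)) :
    r 0 = 1 ∧
    Tendsto (fun t : ℝ => Real.log (r t) / t) (nhdsWithin 0 (Set.Ioi 0))
      (nhds (-lam * ((1 + x) / (1 - x)))) := by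
  obtain ⟨hx0, hx1⟩ := hx
  have h_ne : 1 - x ≠ 0 := by linarith
  have h_sq : (1 + x) ^ 2 - 4 * Real.exp (-lam * 0) * x = (1 - x) ^ 2 := by
    rw [mul_zero, Real.exp_zero]; ring
  have h_sqrt : Real.sqrt ((1 + x) ^ 2 - 4 * Real.exp (-lam * 0) * x) = 1 - x := by
    rw [h_sq, Real.sqrt_sq (by linarith)]
  have h_den : 2 * (1 + x) * Real.sqrt ((1 + x) ^ 2 - 4 * Real.exp (-lam * 0) * x) +
      2 * (1 + x) ^ 2 - 4 * Real.exp (-lam * 0) * x = 4 := by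
    rw [h_sqrt, mul_zero, Real.exp_zero]; ring
  have h_one : r 0 = 1 := by
    rw [hr, h_den, mul_zero, Real.exp_zero]; norm_num
  refine ⟨h_one, ?_⟩
  have h_exp : HasDerivAt (fun t : ℝ => 4 * Real.exp (-lam * t)) (-4 * lam) 0 := by
    refine (((hasDerivAt_id' (0 : ℝ)).const_mul (-lam)).exp.const_mul 4).congr_deriv ?_
    simp
  have h_root := ((h_exp.mul_const x).const_sub ((1 + x) ^ 2)).sqrt
    (by rw [h_sq]; exact pow_ne_zero 2 h_ne)
  have h_quot := h_exp.fun_div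
    (((h_root.const_mul (2 * (1 + x))).add_const (2 * (1 + x) ^ 2)).fun_sub
      (h_exp.mul_const x)) (by rw [h_den]; norm_num)
  rw [h_den, h_sqrt] at h_quot
  have h_deriv : HasDerivAt r (-lam * ((1 + x) / (1 - x))) 0 := by
    rw [funext hr]
    refine h_quot.congr_deriv ?_
    rw [mul_zero, Real.exp_zero]
    field_simp
    ring
  have h_log := h_deriv.log (by rw [h_one]; norm_num)
  rw [h_one, div_one] at h_log
  refine h_log.tendsto_slope_zero_right.congr fun t => ?_
  simp [h_one, div_eq_inv_mul]
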